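/- For every natural number n ≥ 1, ∫_{3−2√2}^{3+2√2} xⁿ · √(8−(x−3)²)/(4πx) dx = (1/n)·Σ_{k=1}^{n} C(n,k)·C(n,k−1)·2^{n−k}; equivalently, for real z near 0, 2/(1+z+√(1−6z+z²)) = 1 + Σ_{n≥1} zⁿ·(1/n)·Σ_{k=1}^{n} C(n,k)·C(n,k−1)·2^{n−k}. -/

import Mathlib

open MeasureTheory

lemma int_cos (k : ℤ) : ∫ θ in (0:ℝ)..Real.pi, Real.cos ((k:ℝ) * θ) = if k = 0 then Real.pi else 0 := by
  split_ifs with h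
  · simp [h]
  · have hk : (k:ℝ) ≠ 0 := by exact_mod_cast h
    rw [intervalIntegral.integral_comp_mul_left (f := Real.cos) hk]
    simp [integral_cos, Real.sin_int_mul_pi]

lemma int_cos_sin2 (k : ℤ) : ∫ θ in (0:ℝ)..Real.pi, Real.cos ((k:ℝ) * θ) * Real.sin θ ^ 2
    = (if k = 0 then Real.pi / 2 else 0) - (if k = 2 then Real.pi/4 else 0)
      - (if k = -2 then Real.pi/4 else 0) := by
  have h : ∀ θ : ℝ, Real.cos ((k:ℝ) * θ) * Real.sin θ ^ 2 =
      (1/2) * Real.cos ((k:ℝ) * θ) - (1/4) * Real.cos (((k-2 : ℤ):ℝ) * θ)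
       - (1/4) * Real.cos (((k+2 : ℤ):ℝ) * θ) := by
    intro θ
    push_cast
    rw [sub_mul, add_mul, Real.cos_sub, Real.cos_add, Real.cos_two_mul, Real.sin_sq]
    ring
  simp_rw [h]
  rw [intervalIntegral.integral_sub, intervalIntegral.integral_sub]
  · simp only [intervalIntegral.integral_const_mul, int_cos]
    have e1 : (k - 2 = 0) ↔ k = 2 := by omega
    have e2 : (k + 2 = 0) ↔ k = -2 := by omega
    simp only [e1, e2]
    split_ifs <;> ring
  all_goals exact Continuous.intervalIntegrable (by fun_prop) _ _

lemma pow_expand (m : ℕ) (θ : ℝ) : (3 + 2 * Real.sqrt 2 * Real.cos θ) ^ m =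
    ∑ j ∈ Finset.range (m+1), ∑ l ∈ Finset.range (m+1),
      ((m.choose j : ℝ) * Real.sqrt 2 ^ j) * ((m.choose l : ℝ) * Real.sqrt 2 ^ l) *
        Real.cos ((((j:ℤ) - (l:ℤ) : ℤ) : ℝ) * θ) := by
  have h2 : Real.sqrt 2 ^ 2 = 2 := Real.sq_sqrt (by norm_num)
  have hP : (1 + (Real.sqrt 2 : ℂ) * Complex.exp (θ * Complex.I)) ^ m =
     ∑ j ∈ Finset.range (m+1), (((m.choose j : ℝ) * Real.sqrt 2 ^ j : ℝ) : ℂ) *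
       Complex.exp (((j * θ : ℝ) : ℂ) * Complex.I) := by
    rw [add_comm, add_pow]
    refine Finset.sum_congr rfl fun j _ => ?_
    rw [mul_pow, ← Complex.exp_nat_mul]
    push_cast
    rw [mul_assoc (j:ℂ)]
    ring
  have hn : (3 + 2 * Real.sqrt 2 * Real.cos θ) ^ m =
      Complex.normSq ((1 + (Real.sqrt 2 : ℂ) * Complex.exp (θ * Complex.I)) ^ m) := by
    rw [map_pow]
    congr 1
    rw [Complex.normSq_apply]
    simp [Complex.exp_ofReal_mul_I_re, Complex.exp_ofReal_mul_I_im]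
    linear_combination (-1) * h2 - (Real.sqrt 2)^2 * Real.sin_sq_add_cos_sq θ
  rw [hn, hP, Complex.normSq_apply, Complex.re_sum, Complex.im_sum]
  simp only [Complex.re_ofReal_mul, Complex.im_ofReal_mul, Complex.exp_ofReal_mul_I_re,
    Complex.exp_ofReal_mul_I_im, Finset.sum_mul_sum, ← Finset.sum_add_distrib]
  refine Finset.sum_congr rfl fun j _ => Finset.sum_congr rfl fun l _ => ?_
  push_cast
  rw [sub_mul, Real.cos_sub]
  ring

lemma nara (m i : ℕ) : ((m:ℝ)+1) * ((m.choose (i+1) : ℝ)^2 - m.choose i * m.choose (i+2)) =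
    ((m+1).choose (i+1) : ℝ) * ((m+1).choose (i+2)) := by
  have h1 : ((m:ℝ)+1) * m.choose i = (m.choose i + m.choose (i+1)) * (i+1) := by
    have := Nat.add_one_mul_choose_eq m i
    rw [Nat.choose_succ_succ] at this
    exact_mod_cast this
  have h2 : ((m:ℝ)+1) * m.choose (i+1) = (m.choose (i+1) + m.choose (i+2)) * (i+2) := by
    have := Nat.add_one_mul_choose_eq m (i+1)
    rw [Nat.choose_succ_succ] at this
    exact_mod_cast this
  rw [Nat.choose_succ_succ m i, Nat.choose_succ_succ m (i+1)]
  push_cast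
  have h1' : ((m:ℝ)+1) * m.choose i = (m.choose i + m.choose (i+1)) * (i+1) := h1
  generalize (m.choose i : ℝ) = a at *
  generalize (m.choose (i+1) : ℝ) = b at *
  simp only [Nat.succ_eq_add_one, show i+1+1 = i+2 from rfl]
  generalize (m.choose (i+2) : ℝ) = c at *
  linear_combination (-c + b - b) * h1 + b * h2 + (a * h2 - b * h1)

lemma T_eval (m : ℕ) : 2 / Real.pi * ∫ θ in (0:ℝ)..Real.pi,
      (3 + 2 * Real.sqrt 2 * Real.cos θ) ^ m * Real.sin θ ^ 2 =
    (1 / ((m:ℝ) + 1)) * ∑ k ∈ Finset.Icc 1 (m + 1),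
            (Nat.choose (m + 1) k : ℝ) * (Nat.choose (m + 1) (k - 1) : ℝ) * 2 ^ (m + 1 - k) := by
  have h2 : Real.sqrt 2 ^ 2 = 2 := Real.sq_sqrt (by norm_num)
  have hr : ∑ k ∈ Finset.Icc 1 (m + 1),
            (Nat.choose (m + 1) k : ℝ) * (Nat.choose (m + 1) (k - 1) : ℝ) * 2 ^ (m + 1 - k)
     = ∑ j ∈ Finset.range (m+1), ((m+1).choose j : ℝ) * ((m+1).choose (j+1)) * 2 ^ j := by
    rw [← Finset.sum_range_reflect]
    have : Finset.Icc 1 (m+1) = Finset.Ico 1 (m+2) := by ext; simp; omega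
    rw [this, Finset.sum_Ico_eq_sum_range]
    refine Finset.sum_congr rfl fun j hj => ?_
    have hj : j < m + 1 := by simpa using hj
    rw [← Nat.choose_symm (n := m+1) (k := 1 + j) (by omega),
      ← Nat.choose_symm (n := m+1) (k := 1 + j - 1) (by omega)]
    rw [show m + 1 - (1 + j) = m + 1 - 1 - j by omega, show m+1 - (1 + j - 1) = m+1-1-j+1 by omega]
  have hT : ∫ θ in (0:ℝ)..Real.pi, (3 + 2 * Real.sqrt 2 * Real.cos θ) ^ m * Real.sin θ ^ 2 =
     ∑ j ∈ Finset.range (m+1), ∑ l ∈ Finset.range (m+1),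
      ((m.choose j : ℝ) * Real.sqrt 2 ^ j) * ((m.choose l : ℝ) * Real.sqrt 2 ^ l) *
       ((if j = l then Real.pi / 2 else 0) - (if j = l + 2 then Real.pi/4 else 0)
      - (if l = j + 2 then Real.pi/4 else 0)) := by
    simp_rw [pow_expand, Finset.sum_mul, mul_assoc _ (Real.cos _)]
    rw [intervalIntegral.integral_finsetSum
      (fun _ _ => Continuous.intervalIntegrable (by fun_prop) _ _)]
    refine Finset.sum_congr rfl fun j _ => ?_
    rw [intervalIntegral.integral_finsetSum
      (fun _ _ => Continuous.intervalIntegrable (by fun_prop) _ _)]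
    refine Finset.sum_congr rfl fun l _ => ?_
    rw [intervalIntegral.integral_const_mul, int_cos_sin2]
    have e1 : ((j:ℤ) - l = 0) ↔ j = l := by omega
    have e2 : ((j:ℤ) - l = 2) ↔ j = l + 2 := by omega
    have e3 : ((j:ℤ) - l = -2) ↔ l = j + 2 := by omega
    simp only [e1, e2, e3]
  have hz : ∀ (f : ℕ → ℝ), (∀ j, m < j → f j = 0) → ∀ j, 
     ∑ l ∈ Finset.range (m+1), f j * f l * (if l = j + 2 then Real.pi/4 else 0) =
       f j * f (j+2) * (Real.pi / 4) := by
    intro f hf j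
    simp only [mul_ite, mul_zero, Finset.sum_ite_eq', Finset.mem_range]
    split_ifs with h
    · rfl
    · rw [hf (j+2) (by omega)]; ring
  set f : ℕ → ℝ := fun j => (m.choose j : ℝ) * Real.sqrt 2 ^ j with hf
  have hf0 : ∀ j, m < j → f j = 0 := by
    intro j hj; simp [hf, Nat.choose_eq_zero_of_lt hj]
  have hT2 : ∫ θ in (0:ℝ)..Real.pi, (3 + 2 * Real.sqrt 2 * Real.cos θ) ^ m * Real.sin θ ^ 2 =
     Real.pi / 2 * ∑ j ∈ Finset.range (m+1), (f j ^ 2 - f j * f (j+2)) := by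
    rw [hT]
    simp only [mul_sub, Finset.sum_sub_distrib]
    have a1 : ∑ j ∈ Finset.range (m+1), ∑ l ∈ Finset.range (m+1),
        f j * f l * (if j = l then Real.pi / 2 else 0) = Real.pi / 2 * ∑ j ∈ Finset.range (m+1), f j ^ 2 := by
      rw [Finset.mul_sum]
      refine Finset.sum_congr rfl fun j hj => ?_
      simp only [mul_ite, mul_zero, Finset.sum_ite_eq, hj, if_true]
      ring
    have a2 : ∑ j ∈ Finset.range (m+1), ∑ l ∈ Finset.range (m+1),
        f j * f l * (if l = j + 2 then Real.pi / 4 else 0) = Real.pi / 4 * ∑ j ∈ Finset.range (m+1), f j * f (j+2) := by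
      rw [Finset.mul_sum]
      refine Finset.sum_congr rfl fun j hj => ?_
      rw [hz f hf0]; ring
    have a3 : ∑ j ∈ Finset.range (m+1), ∑ l ∈ Finset.range (m+1),
        f j * f l * (if j = l + 2 then Real.pi / 4 else 0) = Real.pi / 4 * ∑ j ∈ Finset.range (m+1), f j * f (j+2) := by
      rw [Finset.sum_comm, ← a2]
      refine Finset.sum_congr rfl fun j hj => Finset.sum_congr rfl fun l hl => ?_
      rw [mul_comm (f l)]
    change (∑ j ∈ Finset.range (m+1), ∑ l ∈ Finset.range (m+1),
        f j * f l * (if j = l then Real.pi / 2 else 0)) - (∑ j ∈ Finset.range (m+1), ∑ l ∈ Finset.range (m+1),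
        f j * f l * (if j = l + 2 then Real.pi / 4 else 0)) - (∑ j ∈ Finset.range (m+1), ∑ l ∈ Finset.range (m+1),
        f j * f l * (if l = j + 2 then Real.pi / 4 else 0)) = _
    rw [a1, a2, a3]; ring
  rw [hT2, hr]
  have hpi := Real.pi_ne_zero
  have hm : (m:ℝ) + 1 ≠ 0 := by positivity
  have key : ((m:ℝ)+1) * ∑ j ∈ Finset.range (m+1), (f j ^ 2 - f j * f (j+2)) =
     ∑ j ∈ Finset.range (m+1), ((m+1).choose j : ℝ) * ((m+1).choose (j+1)) * 2 ^ j := by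
    rw [Finset.sum_sub_distrib]
    have b1 : ∑ j ∈ Finset.range (m+1), f j ^ 2 = ∑ j ∈ Finset.range m, f (j+1) ^ 2 + 1 := by
      rw [Finset.sum_range_succ']; simp [hf]
    have b2 : ∑ j ∈ Finset.range (m+1), f j * f (j+2) = ∑ j ∈ Finset.range m, f j * f (j+2) := by
      rw [Finset.sum_range_succ, hf0 (m+2) (by omega)]; simp
    rw [b1, b2, Finset.sum_range_succ', add_sub_right_comm, ← Finset.sum_sub_distrib, mul_add, Finset.mul_sum]
    congr 1
    · refine Finset.sum_congr rfl fun i _ => ?_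
      rw [← nara m i]
      simp only [hf]
      have e : (2:ℝ)^(i+1) = (Real.sqrt 2 ^ (i+1))^2 := by
        rw [← pow_mul, mul_comm, pow_mul, h2]
      rw [e]; ring
    · simp
  rw [← key]
  field_simp
lemma first_int (m : ℕ) : ∫ x in Set.Ioo (3 - 2 * Real.sqrt 2) (3 + 2 * Real.sqrt 2),
          x ^ (m+1) * (Real.sqrt (8 - (x - 3) ^ 2) / (4 * Real.pi * x)) =
    2 / Real.pi * ∫ θ in (0:ℝ)..Real.pi,
      (3 + 2 * Real.sqrt 2 * Real.cos θ) ^ m * Real.sin θ ^ 2 := by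
  have h2 : Real.sqrt 2 ^ 2 = 2 := Real.sq_sqrt (by norm_num)
  have h0 : 0 ≤ Real.sqrt 2 := Real.sqrt_nonneg 2
  have hpi := Real.pi_ne_zero
  have hpos : 0 < 3 - 2 * Real.sqrt 2 := by nlinarith
  have s1 : ∫ x in Set.Ioo (3 - 2 * Real.sqrt 2) (3 + 2 * Real.sqrt 2),
          x ^ (m+1) * (Real.sqrt (8 - (x - 3) ^ 2) / (4 * Real.pi * x)) =
      ∫ x in (3 - 2 * Real.sqrt 2)..(3 + 2 * Real.sqrt 2),
          x ^ m * Real.sqrt (8 - (x - 3) ^ 2) / (4 * Real.pi) := by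
    rw [intervalIntegral.integral_of_le (by linarith), integral_Ioc_eq_integral_Ioo]
    refine setIntegral_congr_fun measurableSet_Ioo fun x hx => ?_
    have : x ≠ 0 := by have := hx.1; intro h; linarith
    field_simp
    ring
  have s2 := intervalIntegral.integral_comp_mul_deriv (a := Real.pi) (b := 0)
    (f := fun θ => 3 + 2 * Real.sqrt 2 * Real.cos θ)
    (f' := fun θ => 2 * Real.sqrt 2 * (- Real.sin θ))
    (g := fun x => x ^ m * Real.sqrt (8 - (x - 3) ^ 2) / (4 * Real.pi))
    (fun x _ => ((Real.hasDerivAt_cos x).const_mul _).const_add _)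
    (by fun_prop) (by fun_prop)
  simp only [Real.cos_pi, Real.cos_zero, mul_one, mul_neg, ← sub_eq_add_neg] at s2
  rw [s1, ← s2, intervalIntegral.integral_symm, ← intervalIntegral.integral_neg,
    ← intervalIntegral.integral_const_mul]
  refine intervalIntegral.integral_congr fun θ hθ => ?_
  rw [Set.uIcc_of_le Real.pi_pos.le] at hθ
  have hs := Real.sin_nonneg_of_mem_Icc hθ
  have : Real.sqrt (8 - (3 + 2 * Real.sqrt 2 * Real.cos θ - 3) ^ 2) = 2 * Real.sqrt 2 * Real.sin θ := by
    rw [Real.sqrt_eq_iff_eq_sq]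
    · rw [mul_pow, Real.sin_sq]
      linear_combination (-4) * h2
    · have : 8 - (3 + 2 * Real.sqrt 2 * Real.cos θ - 3) ^ 2 = 8 * Real.sin θ ^ 2 := by
        rw [Real.sin_sq]
        linear_combination (-4 * Real.cos θ ^ 2) * h2
      rw [this]; positivity
    · positivity
  simp only [Function.comp, this]
  field_simp
  linear_combination (2 * Real.sin θ ^ 2 * (3 + 2 * Real.sqrt 2 * Real.cos θ)^m) * h2

lemma int_sin_sin (n : ℕ) : ∫ θ in (0:ℝ)..Real.pi, Real.sin ((n+1) * θ) * Real.sin θ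
    = if n = 0 then Real.pi / 2 else 0 := by
  have h : ∀ θ : ℝ, Real.sin (((n:ℝ)+1) * θ) * Real.sin θ =
      (1/2) * Real.cos (((n : ℤ):ℝ) * θ) - (1/2) * Real.cos (((n+2 : ℤ):ℝ) * θ) := by
    intro θ
    have e1 : ((n:ℤ):ℝ) * θ = ((n:ℝ)+1) * θ - θ := by push_cast; ring
    have e2 : ((n + 2 : ℤ):ℝ) * θ = ((n:ℝ)+1) * θ + θ := by push_cast; ring
    rw [e1, e2, Real.cos_sub, Real.cos_add]; ring
  simp_rw [h]
  rw [intervalIntegral.integral_sub]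
  · simp only [intervalIntegral.integral_const_mul, int_cos]
    have e2 : ¬ ((n:ℤ) + 2 = 0) := by omega
    simp only [e2, if_false, Nat.cast_eq_zero]
    split_ifs <;> ring
  all_goals exact Continuous.intervalIntegrable (by fun_prop) _ _

lemma poisson_sum (r θ : ℝ) (hr : |r| < 1) :
    HasSum (fun n : ℕ => r ^ n * Real.sin ((n+1) * θ)) (Real.sin θ / (1 - 2 * r * Real.cos θ + r^2)) := by
  have hn : ‖(r:ℂ) * Complex.exp (θ * Complex.I)‖ < 1 := by
    rw [norm_mul, Complex.norm_exp_ofReal_mul_I]; simpa using hr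
  have h := ((hasSum_geometric_of_norm_lt_one hn).mul_left (Complex.exp (θ * Complex.I)))
  have h' := Complex.hasSum_im h
  convert h' using 1
  · ext n
    have : Complex.exp (θ * Complex.I) * ((r:ℂ) * Complex.exp (θ * Complex.I)) ^ n =
      ((r ^ n : ℝ) : ℂ) * Complex.exp (((((n:ℝ)+1) * θ : ℝ) : ℂ) * Complex.I) := by
      have : ((((n:ℝ)+1) * θ : ℝ) : ℂ) * Complex.I = θ * Complex.I + n * (θ * Complex.I) := by
        push_cast; ring
      rw [this, Complex.exp_add, Complex.exp_nat_mul, mul_pow]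
      push_cast; ring
    rw [this, Complex.im_ofReal_mul, Complex.exp_ofReal_mul_I_im]
  · rw [← div_eq_mul_inv, Complex.div_im]
    have : Complex.normSq (1 - (r:ℂ) * Complex.exp (θ * Complex.I)) = 1 - 2 * r * Real.cos θ + r^2 := by
      rw [Complex.normSq_apply]
      simp [Complex.exp_ofReal_mul_I_re, Complex.exp_ofReal_mul_I_im]
      linear_combination r^2 * Real.sin_sq_add_cos_sq θ
    rw [this]
    simp [Complex.exp_ofReal_mul_I_re, Complex.exp_ofReal_mul_I_im]
    ring

lemma poisson_int (r : ℝ) (hr : |r| < 1) :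
    ∫ θ in (0:ℝ)..Real.pi, Real.sin θ ^ 2 / (1 - 2 * r * Real.cos θ + r^2) = Real.pi / 2 := by
  have h := intervalIntegral.hasSum_integral_of_dominated_convergence (μ := volume) (a := 0) (b := Real.pi)
    (F := fun (n : ℕ) θ => r ^ n * Real.sin ((n+1) * θ) * Real.sin θ)
    (f := fun θ => Real.sin θ / (1 - 2 * r * Real.cos θ + r^2) * Real.sin θ)
    (bound := fun n _ => |r| ^ n)
    (fun n => Continuous.aestronglyMeasurable (by fun_prop))
    (fun n => Filter.Eventually.of_forall fun θ _ => by
      rw [Real.norm_eq_abs, abs_mul, abs_mul, abs_pow]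
      have a1 := Real.abs_sin_le_one ((n+1) * θ)
      have a2 := Real.abs_sin_le_one θ
      have a3 : 0 ≤ |r|^n := by positivity
      calc _ ≤ |r|^n * 1 * 1 := by gcongr
        _ = _ := by ring)
    (Filter.Eventually.of_forall fun θ _ => summable_geometric_of_lt_one (abs_nonneg r) hr)
    (by simp)
    (Filter.Eventually.of_forall fun θ _ => (poisson_sum r θ hr).mul_right _)
  have h2 : HasSum (fun n : ℕ => ∫ θ in (0:ℝ)..Real.pi, r ^ n * Real.sin ((n+1) * θ) * Real.sin θ) (Real.pi/2) := by
    have : (fun n : ℕ => ∫ θ in (0:ℝ)..Real.pi, r ^ n * Real.sin ((n+1) * θ) * Real.sin θ) =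
       fun n => if n = 0 then Real.pi / 2 else 0 := by
      ext n
      simp_rw [mul_assoc]
      rw [intervalIntegral.integral_const_mul, int_sin_sin]
      split_ifs with h <;> simp [h]
    rw [this]
    exact hasSum_ite_eq 0 _
  rw [← h.unique h2]
  congr 1; ext θ; ring

lemma hasSum_transfer {F G : ℕ → ℝ} {a b : ℝ} (h : HasSum F a) (h1 : G = F) (h2 : b = a) :
    HasSum G b := by
  subst h1 h2; exact h

lemma gen (z : ℝ) (hz : |z| < 1/10) : HasSum (fun n : ℕ => z ^ (n+1) * 
   (2 / Real.pi * ∫ θ in (0:ℝ)..Real.pi,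
      (3 + 2 * Real.sqrt 2 * Real.cos θ) ^ n * Real.sin θ ^ 2)) 
    (2 / (1 + z + Real.sqrt (1 - 6 * z + z ^ 2)) - 1) := by
  have h2 : Real.sqrt 2 ^ 2 = 2 := Real.sq_sqrt (by norm_num)
  have h0 : 0 ≤ Real.sqrt 2 := Real.sqrt_nonneg 2
  have h15 : Real.sqrt 2 ≤ 3/2 := by nlinarith
  have hpi := Real.pi_ne_zero
  obtain ⟨hz1, hz2⟩ := abs_lt.1 hz
  obtain ⟨s, hs⟩ : ∃ s, s = Real.sqrt (1 - 6 * z + z ^ 2) := ⟨_, rfl⟩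
  rw [← hs]
  have hs0 : 0 ≤ s := hs ▸ Real.sqrt_nonneg _
  have hs2 : s ^ 2 = 1 - 6 * z + z ^ 2 := by rw [hs]; exact Real.sq_sqrt (by nlinarith)
  obtain ⟨c, hc⟩ : ∃ c, c = (1 - 3 * z + s) / 2 := ⟨_, rfl⟩
  have hcpos : 35/100 < c := by rw [hc]; linarith
  have hcp : 0 < c := by linarith
  obtain ⟨r, hrdef⟩ : ∃ r, r = Real.sqrt 2 * z / c := ⟨_, rfl⟩
  have hr : |r| < 1 := by
    rw [hrdef, abs_div, abs_of_pos hcp, div_lt_one hcp, abs_mul, abs_of_nonneg h0]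
    nlinarith [abs_nonneg z]
  have hcr : c * r = Real.sqrt 2 * z := by rw [hrdef]; field_simp
  have hcr2 : c * (1 + r^2) = 1 - 3 * z := by
    have : c * (c * (1 + r^2)) = c * (1 - 3*z) := by
      have : c * (c * (1 + r^2)) = c^2 + (c*r)^2 := by ring
      rw [this, hcr, mul_pow, h2, hc]
      linear_combination hs2 / 4
    exact mul_left_cancel₀ hcp.ne' this
  have hx : ∀ θ, |z * (3 + 2 * Real.sqrt 2 * Real.cos θ)| ≤ 6/10 := by
    intro θ
    rw [abs_mul]
    have : |3 + 2 * Real.sqrt 2 * Real.cos θ| ≤ 6 := by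
      have a := Real.neg_one_le_cos θ
      have b := Real.cos_le_one θ
      rw [abs_le]; constructor <;> nlinarith
    calc _ ≤ (1/10) * (6:ℝ) := by gcongr
      _ = _ := by norm_num
  have g1 : ∀ θ, HasSum (fun n : ℕ => (2 / Real.pi * z * Real.sin θ ^ 2) * (z * (3 + 2 * Real.sqrt 2 * Real.cos θ)) ^ n)
      ((2 / Real.pi * z * Real.sin θ ^ 2) * (1 - (z * (3 + 2 * Real.sqrt 2 * Real.cos θ)))⁻¹) := by
    intro θ
    have hlt : ‖z * (3 + 2 * Real.sqrt 2 * Real.cos θ)‖ < 1 := by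
      rw [Real.norm_eq_abs]
      have := hx θ
      linarith
    exact (hasSum_geometric_of_norm_lt_one hlt).mul_left _
  have g2 : Summable (fun n : ℕ => |2 / Real.pi * z| * (6/10 : ℝ) ^ n) := by
    have : Summable (fun n : ℕ => (6/10 : ℝ) ^ n) :=
      summable_geometric_of_lt_one (by norm_num) (by norm_num)
    exact this.mul_left _
  have g3 : ∀ (n : ℕ) (θ : ℝ), ‖(2 / Real.pi * z * Real.sin θ ^ 2) * (z * (3 + 2 * Real.sqrt 2 * Real.cos θ)) ^ n‖
      ≤ |2 / Real.pi * z| * (6/10 : ℝ) ^ n := by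
    intro n θ
    rw [Real.norm_eq_abs, abs_mul, abs_mul _ (Real.sin θ ^ 2), abs_pow _ n]
    have a2 : |Real.sin θ ^ 2| ≤ 1 := by
      rw [abs_of_nonneg (sq_nonneg _)]; exact Real.sin_sq_le_one θ
    have a3 : |z * (3 + 2 * Real.sqrt 2 * Real.cos θ)| ^ n ≤ (6/10 : ℝ) ^ n :=
      pow_le_pow_left₀ (abs_nonneg _) (hx θ) n
    have a4 : |2 / Real.pi * z| * |Real.sin θ ^ 2| ≤ |2 / Real.pi * z| :=
      mul_le_of_le_one_right (abs_nonneg _) a2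
    exact mul_le_mul a4 a3 (by positivity) (abs_nonneg _)
  have h := intervalIntegral.hasSum_integral_of_dominated_convergence (μ := volume) (a := 0) (b := Real.pi)
    (F := fun (n : ℕ) θ => (2 / Real.pi * z * Real.sin θ ^ 2) * (z * (3 + 2 * Real.sqrt 2 * Real.cos θ)) ^ n)
    (f := fun θ => (2 / Real.pi * z * Real.sin θ ^ 2) * (1 - (z * (3 + 2 * Real.sqrt 2 * Real.cos θ)))⁻¹)
    (bound := fun n _ => |2 / Real.pi * z| * (6/10 : ℝ) ^ n)
    (fun n => Continuous.aestronglyMeasurable (by fun_prop))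
    (fun n => Filter.Eventually.of_forall fun θ _ => g3 n θ)
    (Filter.Eventually.of_forall fun θ _ => g2)
    intervalIntegrable_const
    (Filter.Eventually.of_forall fun θ _ => g1 θ)
  refine hasSum_transfer h ?_ ?_
  · ext n
    rw [← mul_assoc, ← intervalIntegral.integral_const_mul]
    congr 1; ext θ
    rw [mul_pow]; ring
  · have e : ∀ θ, (2 / Real.pi * z * Real.sin θ ^ 2) * (1 - (z * (3 + 2 * Real.sqrt 2 * Real.cos θ)))⁻¹
       = (2 / Real.pi * z / c) * (Real.sin θ ^ 2 / (1 - 2 * r * Real.cos θ + r^2)) := by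
      intro θ
      have : 1 - (z * (3 + 2 * Real.sqrt 2 * Real.cos θ)) = c * (1 - 2 * r * Real.cos θ + r^2) := by
        linear_combination (2 * Real.cos θ) * hcr - hcr2
      rw [this, mul_inv]; ring
    simp_rw [e]
    rw [intervalIntegral.integral_const_mul, poisson_int r hr]
    have hd : 1 + z + s ≠ 0 := by linarith
    have hc' : 1 - 3 * z + s ≠ 0 := by linarith
    have e2 : 2 / Real.pi * z / c * (Real.pi / 2) = z / c := by field_simp
    rw [e2, div_sub_one hd, div_eq_div_iff hd hcp.ne', hc]
    linear_combination (-1/2) * hs2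

theorem stmt_17 :
    (∀ n : ℕ, 1 ≤ n →
      ∫ x in Set.Ioo (3 - 2 * Real.sqrt 2) (3 + 2 * Real.sqrt 2),
          x ^ n * (Real.sqrt (8 - (x - 3) ^ 2) / (4 * Real.pi * x))
        = (1 / (n : ℝ)) * ∑ k ∈ Finset.Icc 1 n,
            (Nat.choose n k : ℝ) * (Nat.choose n (k - 1) : ℝ) * 2 ^ (n - k)) ∧
    (∃ ε > (0 : ℝ), ∀ z : ℝ, |z| < ε →
      HasSum
        (fun n : ℕ =>
          z ^ (n + 1) * ((1 / ((n : ℝ) + 1)) * ∑ k ∈ Finset.Icc 1 (n + 1),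
            (Nat.choose (n + 1) k : ℝ) * (Nat.choose (n + 1) (k - 1) : ℝ) * 2 ^ (n + 1 - k)))
        (2 / (1 + z + Real.sqrt (1 - 6 * z + z ^ 2)) - 1)) := by
  refine ⟨?_, 1/10, by norm_num, fun z hz => ?_⟩
  · intro n hn
    obtain ⟨m, rfl⟩ : ∃ m, n = m + 1 := ⟨n - 1, by omega⟩
    rw [first_int, T_eval]
    push_cast
    rfl
  · have h := gen z hz
    simp only [T_eval] at h
    exact h
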